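/- Let α be a type and H : α → α → α a combiner. For any nonempty list hs of leaf hashes and any index i < hs.length, recomputing the root from the leaf hash hs[i] and the inclusion proof generated for index i yields exactly the Merkle root of hs (completeness of inclusion proofs). -/

import Mathlib

/-- Side of a sibling hash in an inclusion proof. -/
inductive Side
  | left
  | right
deriving DecidableEq, Repr

/-- One Merkle level step: combine consecutive pairs with `H`,
promoting an unpaired final element unchanged. -/
def levelStep {α : Type*} (H : α → α → α) : List α → List α
  | a :: b :: rest => H a b :: levelStep H rest
  | l => l

theorem levelStep_length {α : Type*} (H : α → α → α) :
    (l : List α) → (levelStep H l).length = (l.length + 1) / 2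
  | [] => by simp [levelStep]
  | [_] => by simp [levelStep]
  | a :: b :: rest => by
      simp only [levelStep, List.length_cons, levelStep_length H rest]
      omega

/-- The Merkle root of a list of leaf hashes (`none` on the empty list),
obtained by iterating the level step until a single hash remains. -/
def merkleRoot? {α : Type*} (H : α → α → α) : List α → Option α
  | [] => none
  | [a] => some a
  | a :: b :: rest => merkleRoot? H (levelStep H (a :: b :: rest))
termination_by l => l.length
decreasing_by
  simp only [levelStep_length, List.length_cons]
  omega

/-- The inclusion proof for leaf index `i`: the list of sibling hashes,
tagged with their side, along the path from leaf `i` to the root. -/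
def merkleProof {α : Type*} (H : α → α → α) : List α → ℕ → List (Side × α)
  | [], _ => []
  | [_], _ => []
  | (a :: b :: rest), i =>
      (if i % 2 = 0 then
        match (a :: b :: rest)[i + 1]? with
        | some s => [(Side.right, s)]
        | none => []
      else
        match (a :: b :: rest)[i - 1]? with
        | some s => [(Side.left, s)]
        | none => []) ++ merkleProof H (levelStep H (a :: b :: rest)) (i / 2)
termination_by l _ => l.length
decreasing_by
  simp only [levelStep_length, List.length_cons]
  omega

/-- Recompute a candidate root from a leaf hash and an inclusion proof. -/
def recomputeRoot {α : Type*} (H : α → α → α) (h : α) (π : List (Side × α)) : α :=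
  π.foldl (fun acc p =>
    match p.1 with
    | Side.left => H p.2 acc
    | Side.right => H acc p.2) h

/-- The sibling list at one level. -/
def sibAux {α : Type*} (l : List α) (i : ℕ) : List (Side × α) :=
  if i % 2 = 0 then
    match l[i + 1]? with
    | some s => [(Side.right, s)]
    | none => []
  else
    match l[i - 1]? with
    | some s => [(Side.left, s)]
    | none => []

theorem sibAux_add_two {α : Type*} (a b : α) (l : List α) (i : ℕ) :
    sibAux (a :: b :: l) (i + 2) = sibAux l i := by
  unfold sibAux
  rw [Nat.add_mod_right]
  split
  · rfl
  · rename_i h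
    obtain ⟨j, rfl⟩ : ∃ j, i = j + 1 := ⟨i - 1, by omega⟩
    rfl

theorem levelStep_sibAux {α : Type*} (H : α → α → α) :
    (l : List α) → (i : ℕ) → (x : α) → l[i]? = some x →
      (levelStep H l)[i / 2]? = some (recomputeRoot H x (sibAux l i))
  | [], i, x, h => by simp at h
  | [a], 0, x, h => by simpa [levelStep, sibAux, recomputeRoot] using h
  | [a], i + 1, x, h => by simp at h
  | a :: b :: r, 0, x, h => by
      simp at h
      simp [levelStep, sibAux, recomputeRoot, h]
  | a :: b :: r, 1, x, h => by
      simp at h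
      simp [levelStep, sibAux, recomputeRoot, h]
  | a :: b :: r, i + 2, x, h => by
      have := levelStep_sibAux H r i x (by simpa using h)
      rw [sibAux_add_two, ← this, Nat.add_div_right i (by norm_num)]
      simp [levelStep]

theorem complete_aux {α : Type*} (H : α → α → α) (n : ℕ) :
    ∀ (l : List α) (i : ℕ) (x : α), l.length ≤ n → l[i]? = some x →
      merkleRoot? H l = some (recomputeRoot H x (merkleProof H l i)) := by
  induction n with
  | zero =>
    intro l i x hl h
    have : l = [] := List.length_eq_zero_iff.mp (by omega)
    subst this
    simp at h
  | succ n ih =>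
    intro l i x hl h
    match l, hl, h with
    | [], hl, h => simp at h
    | [a], hl, h =>
      have hi : i = 0 := by
        have := (List.getElem?_eq_some_iff.mp h).1
        simpa using this
      subst hi
      simpa [merkleRoot?, merkleProof, recomputeRoot] using h
    | a :: b :: r, hl, h =>
      have e : merkleProof H (a :: b :: r) i
          = sibAux (a :: b :: r) i ++ merkleProof H (levelStep H (a :: b :: r)) (i / 2) := by
        rw [merkleProof, sibAux]
      rw [merkleRoot?, e]
      rw [ih _ (i / 2) _ _ (levelStep_sibAux H _ i x h)]
      · simp only [recomputeRoot, List.foldl_append]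
      · rw [levelStep_length]
        simp only [List.length_cons] at hl ⊢
        omega

/-- **Completeness of inclusion proofs.** For any nonempty list `hs` of leaf
hashes and any index `i < hs.length`, recomputing the root from the leaf hash
`hs[i]` and the inclusion proof generated for index `i` yields exactly the
Merkle root of `hs`. -/
theorem recomputeRoot_merkleProof_eq_merkleRoot {α : Type*} (H : α → α → α)
    (hs : List α) (hne : hs ≠ []) (i : ℕ) (hi : i < hs.length) :
    merkleRoot? H hs = some (recomputeRoot H hs[i] (merkleProof H hs i)) := by
  exact complete_aux H _ hs i _ le_rfl (List.getElem?_eq_getElem hi)
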